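/- arXiv:2402.18170 — 2 statements merged into one kernel-verified Lean document; each statement's English description precedes it below -/
import Mathlib

section
/- Let C be a category, W a wide subgroupoid of C, and (Q, π) a quotient of C by W, i.e. Q is a category and π : C ⥤ Q is a W-strict functor such that every W-strict functor out of C factors uniquely through π. For each category D (in the same fixed universe) let F_D : (Q ⥤ D) ⥤ (C ⥤ D) be the functor given by precomposition with π (whiskering left by π). Then the following are equivalent: (i) W is rigid; (ii) there exist functors Ψ_D : (C ⥤ D) ⥤ (Q ⥤ D), one for each category D, together with natural isomorphisms F_D ⋙ Ψ_D ≅ 𝟭 and Ψ_D ⋙ F_D ≅ 𝟭, such that the family Ψ_D is natural in D in the sense that for every functor H : D ⥤ D' one has the strict equality (whiskering right by H on C ⥤ D) ⋙ Ψ_{D'} = Ψ_D ⋙ (whiskering right by H on Q ⥤ D); i.e. the precomposition functors F_D form a family of equivalences of categories natural in D. -/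
open CategoryTheory

universe w v' v u' u

/-- A wide subgroupoid of a category `C`: a family of morphisms of `C`, all of which are
isomorphisms, containing all identities and closed under composition and inverses. -/
structure WideSubgroupoid (C : Type u) [Category.{v} C] where
  /-- membership of a morphism in the wide subgroupoid -/
  mem : ∀ ⦃x y : C⦄, (x ⟶ y) → Prop
  id_mem : ∀ x : C, mem (𝟙 x)
  comp_mem : ∀ ⦃x y z : C⦄ ⦃f : x ⟶ y⦄ ⦃g : y ⟶ z⦄, mem f → mem g → mem (f ≫ g)
  is_iso : ∀ ⦃x y : C⦄ ⦃f : x ⟶ y⦄, mem f → IsIso f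
  inv_mem : ∀ ⦃x y : C⦄ ⦃f : x ⟶ y⦄ ⦃g : y ⟶ x⦄, mem f → f ≫ g = 𝟙 x → mem g

variable {C : Type u} [Category.{v} C]

/-- A wide subgroupoid is rigid when any two parallel morphisms belonging to it are equal. -/
def WideSubgroupoid.Rigid (W : WideSubgroupoid C) : Prop :=
  ∀ ⦃x y : C⦄ ⦃f g : x ⟶ y⦄, W.mem f → W.mem g → f = g

/-- A functor is `W`-strict when it sends every morphism of `W` to an identity morphism
(in particular it sends the source and the target of such a morphism to the same object). -/
def WideSubgroupoid.IsStrict (W : WideSubgroupoid C) {D : Type u'} [Category.{v'} D]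
    (F : C ⥤ D) : Prop :=
  ∀ ⦃x y : C⦄ ⦃f : x ⟶ y⦄, W.mem f → ∃ h : F.obj x = F.obj y, F.map f = eqToHom h

/-- `π : C ⥤ Q` exhibits `Q` as a quotient of `C` by the wide subgroupoid `W`: `π` is
`W`-strict, and every `W`-strict functor out of `C` factors uniquely through `π`. -/
structure WideSubgroupoid.IsQuotient (W : WideSubgroupoid C) {Q : Type u'}
    [Category.{v'} Q] (π : C ⥤ Q) : Prop where
  strict : W.IsStrict π
  factors : ∀ {D : Type max u v} [Category.{max u v} D] (F : C ⥤ D),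
    W.IsStrict F → ∃! F' : Q ⥤ D, π ⋙ F' = F

universe w₁

/-- The value of a `W`-strict functor on a morphism of `W` only depends on its endpoints. -/
theorem WideSubgroupoid.IsStrict.map_eq {W : WideSubgroupoid C} {D : Type u'} [Category.{v'} D]
    {F : C ⥤ D} (hF : W.IsStrict F) {x y : C} {f g : x ⟶ y} (hf : W.mem f) (hg : W.mem g) :
    F.map f = F.map g := by
  obtain ⟨_, h₁⟩ := hF hf
  obtain ⟨_, h₂⟩ := hF hg
  rw [h₁, h₂]

theorem WideSubgroupoid.IsStrict.comp {W : WideSubgroupoid C} {D : Type u'} [Category.{v'} D]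
    {F : C ⥤ D} (hF : W.IsStrict F) {E : Type w} [Category.{w₁} E] (G : D ⥤ E) :
    W.IsStrict (F ⋙ G) := by
  intro x y f hf
  obtain ⟨e, he⟩ := hF hf
  exact ⟨congrArg G.obj e, by simp [he, eqToHom_map]⟩

theorem WideSubgroupoid.eqToHom_mem (W : WideSubgroupoid C) {x y : C} (e : x = y) :
    W.mem (eqToHom e) := by
  subst e
  exact W.id_mem x

/-- The functor to the arrow category determined by a natural transformation. -/
def natTransToArrow {D : Type u'} [Category.{v'} D] {F G : C ⥤ D} (α : F ⟶ G) : C ⥤ Arrow D where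
  obj x := Arrow.mk (α.app x)
  map f := Arrow.homMk (F.map f) (G.map f) (by simp)

/-- A morphism of arrows whose two components are identities up to equality of objects is
itself an identity up to equality of objects. -/
theorem Arrow.hom_eq_eqToHom {D : Type u'} [Category.{v'} D] {x y x' y' : D} {f : x ⟶ y}
    {g : x' ⟶ y'} (φ : Arrow.mk f ⟶ Arrow.mk g)
    (hl : ∃ e : x = x', φ.left = eqToHom e) (hr : ∃ e : y = y', φ.right = eqToHom e) :
    ∃ e : Arrow.mk f = Arrow.mk g, φ = eqToHom e := by
  obtain ⟨rfl, h₁⟩ := hl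
  obtain ⟨rfl, h₂⟩ := hr
  rw [eqToHom_refl] at h₁ h₂
  obtain rfl : f = g := by
    have w := Arrow.w_mk_right φ
    rw [h₁, h₂] at w
    exact (Category.comp_id f).symm.trans (w.symm.trans (Category.id_comp g))
  exact ⟨rfl, Arrow.hom_ext _ _ h₁ h₂⟩

theorem WideSubgroupoid.IsStrict.natTransToArrow {W : WideSubgroupoid C} {D : Type u'}
    [Category.{v'} D] {F G : C ⥤ D} (hF : W.IsStrict F) (hG : W.IsStrict G) (α : F ⟶ G) :
    W.IsStrict (natTransToArrow α) :=
  fun _ _ _ hf => Arrow.hom_eq_eqToHom _ (hF hf) (hG hf)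

section Quotient

variable {W : WideSubgroupoid C} {Q : Type u'} [Category.{v'} Q] {π : C ⥤ Q}
  {D : Type max u v} [Category.{max u v} D]

theorem WideSubgroupoid.IsQuotient.functor_ext (h : W.IsQuotient π) {F G : Q ⥤ D}
    (e : π ⋙ F = π ⋙ G) : F = G :=
  (h.factors (π ⋙ G) (h.strict.comp G)).unique e rfl

theorem WideSubgroupoid.IsQuotient.whiskeringLeft_faithful (h : W.IsQuotient π) :
    ((Functor.whiskeringLeft C Q D).obj π).Faithful where
  map_injective {F G α β} e := by
    have key : natTransToArrow α = natTransToArrow β := by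
      apply h.functor_ext
      change natTransToArrow (Functor.whiskerLeft π α) = natTransToArrow (Functor.whiskerLeft π β)
      exact congrArg natTransToArrow e
    ext q
    exact Arrow.mk_injective _ _ (Functor.congr_obj key q)

theorem WideSubgroupoid.IsQuotient.whiskeringLeft_full (h : W.IsQuotient π) :
    ((Functor.whiskeringLeft C Q D).obj π).Full where
  map_surjective {F G} α := by
    have hs := (h.strict.comp F).natTransToArrow (h.strict.comp G) α
    obtain ⟨T, hT, -⟩ := h.factors _ hs
    obtain rfl : T ⋙ Arrow.leftFunc = F :=
      h.functor_ext (congrArg (fun K => K ⋙ Arrow.leftFunc) hT)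
    obtain rfl : T ⋙ Arrow.rightFunc = G :=
      h.functor_ext (congrArg (fun K => K ⋙ Arrow.rightFunc) hT)
    refine ⟨Functor.whiskerLeft T Arrow.leftToRight, ?_⟩
    ext x
    exact Arrow.mk_injective _ _ (Functor.congr_obj hT x)

end Quotient

namespace WideSubgroupoid

/-- The objects of `C` modulo the relation of being connected by a morphism of `W`. -/
def objSetoid (W : WideSubgroupoid C) : Setoid C where
  r x y := ∃ f : x ⟶ y, W.mem f
  iseqv :=
    { refl := fun x => ⟨𝟙 x, W.id_mem x⟩
      symm := by
        rintro x y ⟨f, hf⟩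
        have := W.is_iso hf
        exact ⟨inv f, W.inv_mem hf (IsIso.hom_inv_id f)⟩
      trans := by
        rintro x y z ⟨f, hf⟩ ⟨g, hg⟩
        exact ⟨f ≫ g, W.comp_mem hf hg⟩ }

/-- A chosen object in the `W`-connected component of `x`. -/
noncomputable def repr (W : WideSubgroupoid C) (x : C) : C :=
  (Quotient.mk W.objSetoid x).out

theorem exists_toRepr (W : WideSubgroupoid C) (x : C) : ∃ f : x ⟶ W.repr x, W.mem f :=
  W.objSetoid.symm (Quotient.mk_out (s := W.objSetoid) x)

theorem repr_eq (W : WideSubgroupoid C) {x y : C} {f : x ⟶ y} (hf : W.mem f) :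
    W.repr x = W.repr y :=
  congrArg Quotient.out (Quotient.sound (s := W.objSetoid) ⟨f, hf⟩)

/-- A chosen isomorphism in `W` from `x` to the representative of its component. -/
noncomputable def isoRepr (W : WideSubgroupoid C) (x : C) : x ≅ W.repr x :=
  have := W.is_iso (W.exists_toRepr x).choose_spec
  asIso (W.exists_toRepr x).choose

theorem isoRepr_hom_mem (W : WideSubgroupoid C) (x : C) : W.mem (W.isoRepr x).hom :=
  (W.exists_toRepr x).choose_spec

theorem isoRepr_inv_mem (W : WideSubgroupoid C) (x : C) : W.mem (W.isoRepr x).inv :=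
  W.inv_mem (W.isoRepr_hom_mem x) (W.isoRepr x).hom_inv_id

/-- The endofunctor of `C` replacing each object by the representative of its component. -/
noncomputable def reprFunctor (W : WideSubgroupoid C) : C ⥤ C where
  obj := W.repr
  map {x y} f := (W.isoRepr x).inv ≫ f ≫ (W.isoRepr y).hom

/-- Every object is naturally isomorphic to its representative. -/
noncomputable def reprFunctorIso (W : WideSubgroupoid C) : W.reprFunctor ≅ 𝟭 C :=
  NatIso.ofComponents (fun x => (W.isoRepr x).symm) (fun {x y} f => by
    change ((W.isoRepr x).inv ≫ f ≫ (W.isoRepr y).hom) ≫ (W.isoRepr y).inv =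
      (W.isoRepr x).inv ≫ f
    simp)

theorem Rigid.isStrict_reprFunctor {W : WideSubgroupoid C} (hW : W.Rigid) :
    W.IsStrict W.reprFunctor :=
  fun x y _ hf => ⟨W.repr_eq hf, hW
    (W.comp_mem (W.isoRepr_inv_mem x) (W.comp_mem hf (W.isoRepr_hom_mem y)))
    (W.eqToHom_mem _)⟩

/-- If `W` is rigid, the quotient functor has a section up to isomorphism. -/
theorem IsQuotient.exists_comp_iso_id {W : WideSubgroupoid C} {Q : Type u'} [Category.{v'} Q]
    {π : C ⥤ Q} (h : W.IsQuotient π) (hW : W.Rigid) : ∃ S : Q ⥤ C, Nonempty (π ⋙ S ≅ 𝟭 C) := by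
  obtain ⟨S, hS, -⟩ := h.factors (D := AsSmall.{max u v} C)
    (W.reprFunctor ⋙ AsSmall.up) (hW.isStrict_reprFunctor.comp _)
  refine ⟨S ⋙ AsSmall.down, ⟨?_ ≪≫ W.reprFunctorIso⟩⟩
  exact eqToIso (congrArg (fun K => K ⋙ AsSmall.down) hS)

/-- If some faithful functor is isomorphic to a `W`-strict functor, then `W` is rigid. -/
theorem rigid_of_iso {W : WideSubgroupoid C} {D : Type u'} [Category.{v'} D]
    {F G : C ⥤ D} (hF : W.IsStrict F) (e : F ≅ G) [G.Faithful] : W.Rigid :=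
  fun _ _ f g hf hg => G.map_injective (by
    rw [← NatIso.naturality_1 e f, ← NatIso.naturality_1 e g, hF.map_eq hf hg])

end WideSubgroupoid

/-- Let `π : C ⥤ Q` be the quotient of `C` by a wide subgroupoid `W`, and for each
category `D` let `F_D : (Q ⥤ D) ⥤ (C ⥤ D)` be precomposition with `π` (whiskering left).
Then `W` is rigid if and only if the functors `F_D` form a family of equivalences of
categories natural in `D`: there are functors `Ψ D : (C ⥤ D) ⥤ (Q ⥤ D)` together with
natural isomorphisms `F_D ⋙ Ψ D ≅ 𝟭` and `Ψ D ⋙ F_D ≅ 𝟭`, the family `Ψ` being strictly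
natural in `D` with respect to postcomposition (whiskering right). -/
theorem WideSubgroupoid.IsQuotient.rigid_iff_precomposition_natural_equivalence
    (W : WideSubgroupoid C) {Q : Type u'} [Category.{v'} Q] (π : C ⥤ Q)
    (h : W.IsQuotient π) :
    W.Rigid ↔
      ∃ Ψ : ∀ (D : Type max u v) [Category.{max u v} D], (C ⥤ D) ⥤ (Q ⥤ D),
        (∀ (D : Type max u v) [Category.{max u v} D],
          Nonempty ((Functor.whiskeringLeft C Q D).obj π ⋙ Ψ D ≅ 𝟭 (Q ⥤ D)) ∧
          Nonempty (Ψ D ⋙ (Functor.whiskeringLeft C Q D).obj π ≅ 𝟭 (C ⥤ D))) ∧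
        (∀ (D : Type max u v) [Category.{max u v} D]
            (D' : Type max u v) [Category.{max u v} D'] (H : D ⥤ D'),
          (Functor.whiskeringRight C D D').obj H ⋙ Ψ D' = Ψ D ⋙ (Functor.whiskeringRight Q D D').obj H) := by
  constructor
  · intro hW
    obtain ⟨S, ⟨e⟩⟩ := h.exists_comp_iso_id hW
    refine ⟨fun D _ => (Functor.whiskeringLeft Q C D).obj S, fun D _ => ?_, fun D _ D' _ H => rfl⟩
    have := h.whiskeringLeft_faithful (D := D)
    have := h.whiskeringLeft_full (D := D)
    let F := (Functor.whiskeringLeft C Q D).obj π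
    let i : (Functor.whiskeringLeft Q C D).obj S ⋙ F ≅ 𝟭 (C ⥤ D) :=
      (Functor.whiskeringLeft C C D).mapIso e
    exact ⟨⟨Functor.fullyFaithfulCancelRight F (Functor.isoWhiskerLeft F i)⟩, ⟨i⟩⟩
  · rintro ⟨Ψ, hΨ, -⟩
    obtain ⟨e⟩ := (hΨ (AsSmall.{max u v} C)).2
    have : (AsSmall.up.{v, u, max u v} : C ⥤ _).Faithful := AsSmall.equiv.faithful_functor
    exact WideSubgroupoid.rigid_of_iso (G := AsSmall.up) (h.strict.comp _) (e.app AsSmall.up)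
end

section
/- Let V be a quiver. For any vertices x and y, every morphism x ⟶ y in the free groupoid on V is represented by exactly one reduced path: the canonical map sending a path from x to y in the symmetrification of V to the morphism it represents in the free groupoid restricts to a bijection between the reduced paths from x to y and the morphisms x ⟶ y of the free groupoid on V. -/
open CategoryTheory

universe v u

/-- A path in the symmetrification of a quiver is reduced when it contains no two
consecutive arrows of which one is the reverse of the other. -/
inductive ReducedPath {V : Type u} [Quiver.{v} V] :
    ∀ {x y : Quiver.Symmetrify V}, Quiver.Path x y → Prop
  | nil {x : Quiver.Symmetrify V} : ReducedPath (Quiver.Path.nil : Quiver.Path x x)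
  | single {x y : Quiver.Symmetrify V} (e : x ⟶ y) : ReducedPath e.toPath
  | cons {x y z w : Quiver.Symmetrify V} (p : Quiver.Path x y) (e : y ⟶ z) (f : z ⟶ w) :
      ReducedPath (p.cons e) →
      (⟨w, f⟩ : Σ t : Quiver.Symmetrify V, z ⟶ t) ≠ ⟨y, Quiver.reverse e⟩ →
      ReducedPath ((p.cons e).cons f)

namespace ReducedPath

open Quiver

variable {V : Type u} [Quiver.{v} V] {x y z w : Symmetrify V}

theorem reverse_ne {p : Path x y} {e : y ⟶ z} {f : z ⟶ w}
    (h : ReducedPath ((p.cons e).cons f)) :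
    (⟨w, f⟩ : Σ t : Symmetrify V, z ⟶ t) ≠ ⟨y, Quiver.reverse e⟩ := by
  cases h with
  | cons _ _ _ _ h => exact h

theorem of_cons {p : Path x y} {e : y ⟶ z} (h : ReducedPath (p.cons e)) : ReducedPath p := by
  cases h with
  | single => exact .nil
  | cons _ _ _ h _ => exact h

end ReducedPath

namespace Quiver.Path

variable {V : Type u} [Quiver.{v} V] {x y z w : Symmetrify V}

open Classical in
/-- Append an arrow to a path, cancelling it against the last arrow of the path if the two are
reverses of each other. -/
noncomputable def reducedCons {x : Symmetrify V} :
    ∀ {y z : Symmetrify V}, Path x y → (y ⟶ z) → Path x z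
  | _, _, nil, e => nil.cons e
  | y, z, cons (b := a) p f, e =>
    if h : (⟨z, e⟩ : Σ t : Symmetrify V, y ⟶ t) = ⟨a, Quiver.reverse f⟩ then
      p.cast rfl (congrArg Sigma.fst h).symm
    else (p.cons f).cons e

@[simp]
theorem reducedCons_cons_reverse (p : Path x y) (e : y ⟶ z) :
    (p.cons e).reducedCons (Quiver.reverse e) = p := by
  simp [reducedCons]

theorem reducedCons_cons_of_ne (p : Path x y) (e : y ⟶ z) (f : z ⟶ w)
    (h : (⟨w, f⟩ : Σ t : Symmetrify V, z ⟶ t) ≠ ⟨y, Quiver.reverse e⟩) :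
    (p.cons e).reducedCons f = (p.cons e).cons f :=
  dif_neg h

theorem reducedCons_eq_cons {p : Path x y} {e : y ⟶ z} (h : ReducedPath (p.cons e)) :
    p.reducedCons e = p.cons e := by
  cases p with
  | nil => rfl
  | cons p f => exact reducedCons_cons_of_ne p f e h.reverse_ne

theorem _root_.ReducedPath.reducedCons {p : Path x y} (hp : ReducedPath p) (e : y ⟶ z) :
    ReducedPath (p.reducedCons e) := by
  cases p with
  | nil => exact .single e
  | @cons a _ p f =>
    by_cases h : (⟨z, e⟩ : Σ t : Symmetrify V, y ⟶ t) = ⟨a, Quiver.reverse f⟩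
    · cases h
      rw [reducedCons_cons_reverse]
      exact hp.of_cons
    · rw [reducedCons_cons_of_ne p f e h]
      exact .cons p f e hp h

theorem reducedCons_reducedCons_reverse {p : Path x y} (hp : ReducedPath p) (e : y ⟶ z) :
    (p.reducedCons e).reducedCons (Quiver.reverse e) = p := by
  cases p with
  | nil => exact reducedCons_cons_reverse nil e
  | @cons a _ p f =>
    by_cases h : (⟨z, e⟩ : Σ t : Symmetrify V, y ⟶ t) = ⟨a, Quiver.reverse f⟩
    · cases h
      rw [reducedCons_cons_reverse, Quiver.reverse_reverse, reducedCons_eq_cons hp]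
    · rw [reducedCons_cons_of_ne p f e h, reducedCons_cons_reverse]

/-- Append a path to another one arrow by arrow, cancelling at each step. -/
noncomputable def reducedComp {x y : Symmetrify V} (p : Path x y) :
    ∀ {z : Symmetrify V}, Path y z → Path x z
  | _, nil => p
  | _, cons q e => (p.reducedComp q).reducedCons e

theorem reducedComp_comp (p : Path x y) (q : Path y z) (r : Path z w) :
    p.reducedComp (q.comp r) = (p.reducedComp q).reducedComp r := by
  induction r with
  | nil => rfl
  | cons r e ih => exact congrArg (reducedCons · e) ih

theorem _root_.ReducedPath.reducedComp {p : Path x y} (hp : ReducedPath p) (q : Path y z) :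
    ReducedPath (p.reducedComp q) := by
  induction q with
  | nil => exact hp
  | cons q e ih => exact ih.reducedCons e

theorem nil_reducedComp {p : Path x y} (hp : ReducedPath p) : nil.reducedComp p = p := by
  induction p with
  | nil => rfl
  | cons p e ih =>
    change (nil.reducedComp p).reducedCons e = _
    rw [ih hp.of_cons, reducedCons_eq_cons hp]

theorem nil_reducedComp_comp_cancel (p : Path x y) (e : y ⟶ z) (q : Path y w) :
    nil.reducedComp (p.comp (nil.comp q)) =
      nil.reducedComp (p.comp ((e.toPath.comp (Quiver.reverse e).toPath).comp q)) := by
  rw [nil_comp, reducedComp_comp, reducedComp_comp, reducedComp_comp]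
  congr 1
  exact (reducedCons_reducedCons_reverse (ReducedPath.nil.reducedComp p) e).symm

end Quiver.Path

namespace Quiver.FreeGroupoid

variable {V : Type u} [Quiver.{v} V] {x y z : Symmetrify V}

/-- The morphism of the free groupoid represented by a path in the symmetrification. -/
abbrev mkPath (p : Path x y) :
    (Quotient.functor (redStep (V := V))).obj ((Paths.of (Symmetrify V)).obj x) ⟶
      (Quotient.functor (redStep (V := V))).obj ((Paths.of (Symmetrify V)).obj y) :=
  (Quotient.functor (redStep (V := V))).map
    (show (Paths.of (Symmetrify V)).obj x ⟶ (Paths.of (Symmetrify V)).obj y from p)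

theorem mkPath_comp (p : Path x y) (q : Path y z) :
    mkPath (p.comp q) = mkPath p ≫ mkPath q :=
  (Quotient.functor (redStep (V := V))).map_comp _ _

theorem mkPath_toPath_comp_reverse (e : x ⟶ y) :
    mkPath (e.toPath.comp (Quiver.reverse e).toPath) = mkPath Path.nil :=
  (CategoryTheory.Quotient.sound _ (redStep.step x y e)).symm

theorem mkPath_reducedCons (p : Path x y) (e : y ⟶ z) :
    mkPath (p.reducedCons e) = mkPath (p.cons e) := by
  cases p with
  | nil => rfl
  | @cons a _ p f =>
    by_cases h : (⟨z, e⟩ : Σ t : Symmetrify V, y ⟶ t) = ⟨a, Quiver.reverse f⟩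
    · cases h
      rw [Path.reducedCons_cons_reverse]
      change mkPath (p.comp Path.nil) = mkPath (p.comp (f.toPath.comp (Quiver.reverse f).toPath))
      rw [mkPath_comp, mkPath_comp, mkPath_toPath_comp_reverse]
    · rw [Path.reducedCons_cons_of_ne p f e h]

theorem mkPath_reducedComp (p : Path x y) (q : Path y z) :
    mkPath (p.reducedComp q) = mkPath (p.comp q) := by
  induction q with
  | nil => rfl
  | cons q e ih =>
    change mkPath ((p.reducedComp q).reducedCons e) = mkPath ((p.comp q).comp e.toPath)
    rw [mkPath_reducedCons, mkPath_comp, ← ih, ← mkPath_comp, Path.comp_toPath_eq_cons]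

theorem nil_reducedComp_eq_of_compClosure {a b : Paths (Symmetrify V)} {p q : a ⟶ b}
    (h : HomRel.CompClosure redStep p q) :
    Path.reducedComp (V := V) Path.nil p = Path.reducedComp (V := V) Path.nil q := by
  obtain ⟨_, _, f, _, _, g, ⟨X, Z, e⟩⟩ := h
  exact Path.nil_reducedComp_comp_cancel (V := V) f e g

theorem nil_reducedComp_eq_of_mkPath_eq {p q : Path x y} (h : mkPath p = mkPath q) :
    Path.nil.reducedComp p = Path.nil.reducedComp q := by
  suffices ∀ {p q : Path x y},
      Relation.EqvGen (HomRel.CompClosure redStep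
        (X := (Paths.of (Symmetrify V)).obj x) (Y := (Paths.of (Symmetrify V)).obj y)) p q →
      Path.nil.reducedComp p = Path.nil.reducedComp q from this (Quot.eqvGen_exact h)
  intro p q h
  induction h with
  | rel _ _ h => exact nil_reducedComp_eq_of_compClosure h
  | refl => rfl
  | symm _ _ _ ih => exact ih.symm
  | trans _ _ _ _ _ ih₁ ih₂ => exact ih₁.trans ih₂

end Quiver.FreeGroupoid

/-- Every morphism of the free groupoid on a quiver `V` is represented by exactly one
reduced path: the canonical map sending a path in the symmetrification of `V` to the
morphism it represents in the free groupoid restricts to a bijection from reduced paths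
from `x` to `y` onto the morphisms `x ⟶ y` of the free groupoid. -/
theorem freeGroupoid_reduced_path_bijective {V : Type u} [Quiver.{v} V] (x y : V) :
    Function.Bijective
      (fun p : { p : Quiver.Path (Quiver.Symmetrify.of.obj x) (Quiver.Symmetrify.of.obj y) //
          ReducedPath p } =>
        (Quotient.functor (Quiver.FreeGroupoid.redStep (V := V))).map
          (show (Paths.of (Quiver.Symmetrify V)).obj (Quiver.Symmetrify.of.obj x) ⟶
              (Paths.of (Quiver.Symmetrify V)).obj (Quiver.Symmetrify.of.obj y) from p.1)) := by
  refine ⟨fun p q h => Subtype.ext ?_, fun f => ?_⟩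
  · rw [← Quiver.Path.nil_reducedComp p.2, ← Quiver.Path.nil_reducedComp q.2]
    exact Quiver.FreeGroupoid.nil_reducedComp_eq_of_mkPath_eq h
  · obtain ⟨p, rfl⟩ := (Quotient.functor (Quiver.FreeGroupoid.redStep (V := V))).map_surjective f
    refine ⟨⟨Quiver.Path.nil.reducedComp p, ReducedPath.nil.reducedComp p⟩, ?_⟩
    exact (Quiver.FreeGroupoid.mkPath_reducedComp Quiver.Path.nil p).trans
      (congrArg Quiver.FreeGroupoid.mkPath (Quiver.Path.nil_comp p))
end
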